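/- (Well-posedness of Problem 2 of the paper in L².) For λ > 0, the penalized least squares functional F(β₀, β) = Σᵢ (yᵢ − β₀ − ⟪xᵢ, β⟫)² + λ·‖β − γ‖² attains its infimum over ℝ × L²(μ) at exactly one point; that is, the L²-penalized functional linear regression problem with nonzero shrinkage target γ has a unique global minimizer (β₀*, β*). -/

import Mathlib

open scoped RealInnerProductSpace BigOperators
open MeasureTheory

section RidgeRegression

variable {ι E : Type*} [Fintype ι] [NormedAddCommGroup E] [InnerProductSpace ℝ E]

/-- The normal equations of ridge regression have a solution. -/
theorem exists_ridge_normal_equation [CompleteSpace E] (u : ι → E) (c : E) {lam : ℝ}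
    (hlam : 0 < lam) :
    ∃ β : E, ∀ h : E, ∑ i, ⟪u i, β⟫ * ⟪u i, h⟫ + lam * ⟪β, h⟫ = ⟪c, h⟫ := by
  let I : E →L[ℝ] E →L[ℝ] ℝ := innerSL ℝ
  let B : E →L[ℝ] E →L[ℝ] ℝ :=
    ∑ i, (I (u i)).smulRight (I (u i)) + lam • I
  have hI (v w : E) : I v w = ⟪v, w⟫ := rfl
  have hB (v w : E) : B v w = ∑ i, ⟪u i, v⟫ * ⟪u i, w⟫ + lam * ⟪v, w⟫ := by
    simp [B, hI, sum_apply]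
  have hcoercive : IsCoercive B := by
    refine ⟨lam, hlam, fun v => ?_⟩
    rw [hB, real_inner_self_eq_norm_mul_norm, mul_assoc]
    exact le_add_of_nonneg_left (Finset.sum_nonneg fun i _ => mul_self_nonneg _)
  refine ⟨hcoercive.continuousLinearEquivOfBilin.symm c, fun h => ?_⟩
  rw [← hB, ← hcoercive.continuousLinearEquivOfBilin_apply,
    ContinuousLinearEquiv.apply_symm_apply]

/-- The normal equations of ridge regression with an unpenalized intercept and shrinkage
target `γ` have a solution. -/
theorem exists_ridge_intercept_normal_equation [CompleteSpace E] [Nonempty ι] (x : ι → E)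
    (y : ι → ℝ) (γ : E) {lam : ℝ} (hlam : 0 < lam) :
    ∃ (β₀ : ℝ) (β : E), ∑ i, (y i - β₀ - ⟪x i, β⟫) = 0 ∧
      ∀ h : E, ∑ i, (y i - β₀ - ⟪x i, β⟫) * ⟪x i, h⟫ = lam * ⟪β - γ, h⟫ := by
  have hcard : (Fintype.card ι : ℝ) ≠ 0 := by simp
  let xbar : E := (Fintype.card ι : ℝ)⁻¹ • ∑ i, x i
  let ybar : ℝ := (Fintype.card ι : ℝ)⁻¹ * ∑ i, y i
  obtain ⟨β, hβ⟩ := exists_ridge_normal_equation (fun i => x i - xbar)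
    (lam • γ + ∑ i, (y i - ybar) • (x i - xbar)) hlam
  have hzero : ∑ i, (y i - (ybar - ⟪xbar, β⟫) - ⟪x i, β⟫) = 0 := by
    simp only [Finset.sum_sub_distrib, Finset.sum_const, Finset.card_univ, nsmul_eq_mul,
      xbar, ybar, real_inner_smul_left, sum_inner]
    field_simp
    ring
  refine ⟨ybar - ⟪xbar, β⟫, β, hzero, fun h => ?_⟩
  have hcenter : ∑ i, (y i - (ybar - ⟪xbar, β⟫) - ⟪x i, β⟫) * ⟪x i, h⟫ =
      ∑ i, ((y i - ybar) * ⟪x i - xbar, h⟫ - ⟪x i - xbar, β⟫ * ⟪x i - xbar, h⟫) := by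
    rw [← sub_eq_zero, ← Finset.sum_sub_distrib]
    calc
      _ = ∑ i, (y i - (ybar - ⟪xbar, β⟫) - ⟪x i, β⟫) * ⟪xbar, h⟫ := by
        refine Finset.sum_congr rfl fun i _ => ?_
        simp only [inner_sub_left]
        ring
      _ = 0 := by rw [← Finset.sum_mul, hzero, zero_mul]
  have hh := hβ h
  simp only [inner_add_left, sum_inner, real_inner_smul_left] at hh
  rw [hcenter, Finset.sum_sub_distrib, inner_sub_left]
  linarith

/-- Around a solution of the normal equations the penalized least squares functional is its
value there plus a quadratic form. -/
theorem ridge_intercept_eq_add_of_normal_equation {x : ι → E} {y : ι → ℝ} {γ : E} {lam : ℝ}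
    {β₀ : ℝ} {β : E} (hzero : ∑ i, (y i - β₀ - ⟪x i, β⟫) = 0)
    (hβ : ∀ h : E, ∑ i, (y i - β₀ - ⟪x i, β⟫) * ⟪x i, h⟫ = lam * ⟪β - γ, h⟫) (a : ℝ) (h : E) :
    ∑ i, (y i - (β₀ + a) - ⟪x i, β + h⟫) ^ 2 + lam * ‖β + h - γ‖ ^ 2 =
      (∑ i, (y i - β₀ - ⟪x i, β⟫) ^ 2 + lam * ‖β - γ‖ ^ 2) +
        (∑ i, (a + ⟪x i, h⟫) ^ 2 + lam * ‖h‖ ^ 2) := by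
  have hsum : ∑ i, (y i - (β₀ + a) - ⟪x i, β + h⟫) ^ 2 =
      ∑ i, (y i - β₀ - ⟪x i, β⟫) ^ 2 + ∑ i, (a + ⟪x i, h⟫) ^ 2 -
        2 * (a * ∑ i, (y i - β₀ - ⟪x i, β⟫) +
          ∑ i, (y i - β₀ - ⟪x i, β⟫) * ⟪x i, h⟫) := by
    simp only [Finset.mul_sum, ← Finset.sum_add_distrib, ← Finset.sum_sub_distrib]
    refine Finset.sum_congr rfl fun i _ => ?_
    rw [inner_add_right]
    ring
  rw [hsum, hzero, hβ, add_sub_right_comm β, norm_add_sq_real]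
  ring

/-- Penalized least squares with an unpenalized intercept and shrinkage target `γ` has a unique
global minimizer in any real Hilbert space. -/
theorem existsUnique_ridge_intercept_minimizer [CompleteSpace E] [Nonempty ι] (x : ι → E)
    (y : ι → ℝ) (γ : E) {lam : ℝ} (hlam : 0 < lam) (F : ℝ × E → ℝ)
    (hF : ∀ (β₀ : ℝ) (β : E),
      F (β₀, β) = ∑ i, (y i - β₀ - ⟪x i, β⟫) ^ 2 + lam * ‖β - γ‖ ^ 2) :
    ∃! m : ℝ × E, ∀ z : ℝ × E, F m ≤ F z := by
  obtain ⟨β₀, β, hzero, hβ⟩ := exists_ridge_intercept_normal_equation x y γ hlam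
  have hexpand (a : ℝ) (h : E) : F (β₀ + a, β + h) =
      F (β₀, β) + (∑ i, (a + ⟪x i, h⟫) ^ 2 + lam * ‖h‖ ^ 2) := by
    rw [hF, hF, ridge_intercept_eq_add_of_normal_equation hzero hβ]
  have hsq (a : ℝ) (h : E) : 0 ≤ ∑ i, (a + ⟪x i, h⟫) ^ 2 :=
    Finset.sum_nonneg fun i _ => sq_nonneg _
  have hpen (h : E) : 0 ≤ lam * ‖h‖ ^ 2 := by positivity
  refine ⟨(β₀, β), ?_, ?_⟩
  · rintro ⟨b₀, b⟩
    have := hexpand (b₀ - β₀) (b - β)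
    rw [add_sub_cancel, add_sub_cancel] at this
    linarith [hsq (b₀ - β₀) (b - β), hpen (b - β)]
  · rintro ⟨b₀, b⟩ hmin
    obtain ⟨a, rfl⟩ : ∃ a, b₀ = β₀ + a := ⟨b₀ - β₀, by ring⟩
    obtain ⟨h, rfl⟩ : ∃ h, b = β + h := ⟨b - β, by abel⟩
    have hle := hmin (β₀, β)
    rw [hexpand] at hle
    have hh : h = 0 := by
      have : lam * ‖h‖ ^ 2 = 0 := by linarith [hsq a h, hpen h]
      simpa [hlam.ne'] using this
    subst hh
    have ha : a = 0 := by
      have : ∑ i : ι, (a + ⟪x i, 0⟫) ^ 2 = 0 := by linarith [hsq a 0, hpen (0 : E)]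
      simpa using this
    simp [ha]

end RidgeRegression

/-- Well-posedness of Problem 2 in `L²`: for `λ > 0`, the penalized least squares
functional `F(β₀, β) = Σᵢ (yᵢ − β₀ − ⟪xᵢ, β⟫)² + λ‖β − γ‖²` has exactly one global
minimizer on `ℝ × L²(μ)`. -/
theorem stmt_14 (N : ℕ) (hN : 0 < N)
    (μ : Measure ℝ) (hμ : μ = volume.restrict (Set.Icc (-1 : ℝ) 1))
    (x : Fin N → Lp ℝ 2 μ) (y : Fin N → ℝ) (γ : Lp ℝ 2 μ)
    (lam : ℝ) (hlam : 0 < lam)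
    (F : ℝ × Lp ℝ 2 μ → ℝ)
    (hF : ∀ (β₀ : ℝ) (β : Lp ℝ 2 μ),
      F (β₀, β) = ∑ i, (y i - β₀ - ⟪x i, β⟫) ^ 2 + lam * ‖β - γ‖ ^ 2) :
    ∃! m : ℝ × Lp ℝ 2 μ, ∀ z : ℝ × Lp ℝ 2 μ, F m ≤ F z := by
  have : Nonempty (Fin N) := ⟨⟨0, hN⟩⟩
  exact existsUnique_ridge_intercept_minimizer x y γ hlam F hF
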